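/- Suppose ργ⁴ ≤ 4096/27, and let t > 0 and x̃ ∈ ℝ. Then the function x ↦ φ(x) + (t/2)(x − x̃)² has a unique global minimizer x* ∈ ℝ, and x* is the unique real solution of the equation 1 − v e^{−x} + ρ(e^x/v − γ√(e^x/v)) + t(x − x̃) = 0; moreover φ is differentiable on ℝ with φ′(x) = 1 − v e^{−x} + ρ(e^x/v − γ√(e^x/v)). -/

import Mathlib

noncomputable section

/-- The pixelwise Exp fidelity `φ(x) = x + v e^{−x} + ρ(√(eˣ/v) − γ)²`. -/
def expFid (v ρ γ : ℝ) (x : ℝ) : ℝ :=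
  x + v * Real.exp (-x) + ρ * (Real.sqrt (Real.exp x / v) - γ) ^ 2

lemma quartic_nonneg {ρ γ m : ℝ} (hρ : 0 < ρ) (hγ : 0 < γ) (h : ρ * γ ^ 4 ≤ 4096 / 27)
    (hm : 0 < m) : 0 ≤ 1 + ρ * (m ^ 4 - γ * m ^ 3 / 2) := by
  have hfac : 0 ≤ ρ * ((m - 3 * γ / 8) ^ 2 * (m ^ 2 + γ * m / 4 + 3 * γ ^ 2 / 64)) := by
    positivity
  linear_combination hfac + 27 / 4096 * h

lemma monotoneOn_fidelity_slope {ρ γ : ℝ} (hρ : 0 < ρ) (hγ : 0 < γ)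
    (h : ρ * γ ^ 4 ≤ 4096 / 27) :
    MonotoneOn (fun s : ℝ => 1 - 1 / s ^ 2 + ρ * (s ^ 2 - γ * s)) (Set.Ioi 0) := by
  intro a (ha : 0 < a) b (hb : 0 < b) hab
  have hq := quartic_nonneg hρ hγ h (m := (a + b) / 2) (by positivity)
  have hmean : 2 / ((a + b) / 2) ^ 3 ≤ (a + b) / (a ^ 2 * b ^ 2) := by
    have hab4 : a ^ 2 * b ^ 2 ≤ ((a + b) / 2) ^ 4 := by
      have : a * b ≤ ((a + b) / 2) ^ 2 := by nlinarith [sq_nonneg (a - b)]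
      nlinarith [pow_le_pow_left₀ (by positivity) this 2]
    rw [div_le_div_iff₀ (by positivity) (by positivity)]
    linear_combination 2 * hab4
  have hpos : 0 ≤ 2 / ((a + b) / 2) ^ 3 + ρ * (a + b - γ) := by
    have : 2 / ((a + b) / 2) ^ 3 + ρ * (a + b - γ) =
        2 / ((a + b) / 2) ^ 3 *
          (1 + ρ * (((a + b) / 2) ^ 4 - γ * ((a + b) / 2) ^ 3 / 2)) := by
      field_simp
    rw [this]
    positivity
  have hdiff : (1 - 1 / b ^ 2 + ρ * (b ^ 2 - γ * b)) - (1 - 1 / a ^ 2 + ρ * (a ^ 2 - γ * a)) =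
      (b - a) * ((a + b) / (a ^ 2 * b ^ 2) + ρ * (a + b - γ)) := by
    field_simp
    ring
  have := mul_nonneg (sub_nonneg.2 hab) (hpos.trans (add_le_add_left hmean _))
  dsimp only
  linarith

/-- The derivative of `expFid`. -/
def expFidDeriv (v ρ γ x : ℝ) : ℝ :=
  1 - v * Real.exp (-x) + ρ * (Real.exp x / v - γ * Real.sqrt (Real.exp x / v))

lemma hasDerivAt_expFid {v : ℝ} (hv : 0 < v) (ρ γ x : ℝ) :
    HasDerivAt (expFid v ρ γ) (expFidDeriv v ρ γ x) x := by
  have hpos : 0 < Real.exp x / v := by positivity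
  have hsqrt := ((Real.hasDerivAt_exp x).div_const v).sqrt hpos.ne'
  have hexp := ((hasDerivAt_neg x).exp).const_mul v
  refine (((hasDerivAt_id x).add hexp).add
    (((hsqrt.sub_const γ).pow 2).const_mul ρ)).congr_deriv ?_
  have hs : 0 < Real.sqrt (Real.exp x / v) := Real.sqrt_pos.2 hpos
  have hsq := Real.sq_sqrt hpos.le
  rw [expFidDeriv]
  generalize Real.sqrt (Real.exp x / v) = s at *
  rw [← hsq]
  field_simp
  ring

lemma expFidDeriv_monotone {v ρ γ : ℝ} (hv : 0 < v) (hρ : 0 < ρ) (hγ : 0 < γ)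
    (h : ρ * γ ^ 4 ≤ 4096 / 27) : Monotone (expFidDeriv v ρ γ) := by
  have key : ∀ x, expFidDeriv v ρ γ x = (fun s : ℝ => 1 - 1 / s ^ 2 + ρ * (s ^ 2 - γ * s))
      (Real.sqrt (Real.exp x / v)) := by
    intro x
    have hpos : 0 < Real.exp x / v := by positivity
    simp only [expFidDeriv, Real.sq_sqrt hpos.le, Real.exp_neg, one_div_div]
    rfl
  intro x y hxy
  rw [key, key]
  exact monotoneOn_fidelity_slope hρ hγ h (Real.sqrt_pos.2 (by positivity))
    (Real.sqrt_pos.2 (by positivity)) (by gcongr)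

lemma exists_zero_of_monotone_add_linear {g : ℝ → ℝ} (hg : Monotone g) (hc : Continuous g)
    {t : ℝ} (ht : 0 < t) (a : ℝ) : ∃ x, g x + t * (x - a) = 0 := by
  have hlow : g (a - |g a| / t) + t * ((a - |g a| / t) - a) ≤ 0 := by
    have h1 : g (a - |g a| / t) ≤ g a := hg (by linarith [div_nonneg (abs_nonneg (g a)) ht.le])
    have h2 : t * ((a - |g a| / t) - a) = -|g a| := by field_simp; ring
    linarith [le_abs_self (g a)]
  have hhigh : 0 ≤ g (a + |g a| / t) + t * ((a + |g a| / t) - a) := by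
    have h1 : g a ≤ g (a + |g a| / t) := hg (by linarith [div_nonneg (abs_nonneg (g a)) ht.le])
    have h2 : t * ((a + |g a| / t) - a) = |g a| := by field_simp; ring
    linarith [neg_abs_le (g a)]
  exact mem_range_of_exists_le_of_exists_ge (f := fun x => g x + t * (x - a))
    (by fun_prop) ⟨_, hlow⟩ ⟨_, hhigh⟩

lemma le_of_hasDerivAt_monotone {f f' : ℝ → ℝ} (hf : ∀ x, HasDerivAt f (f' x) x)
    (hmono : Monotone f') {a : ℝ} (ha : f' a = 0) (x : ℝ) : f a ≤ f x := by
  have hcont : Continuous f := continuous_iff_continuousAt.2 fun x => (hf x).continuousAt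
  rcases le_total a x with hax | hxa
  · refine monotoneOn_of_hasDerivWithinAt_nonneg (convex_Ici a) hcont.continuousOn
      (fun y _ => (hf y).hasDerivWithinAt) (fun y hy => ?_) Set.self_mem_Ici hax hax
    rw [interior_Ici] at hy
    exact ha ▸ hmono (le_of_lt hy)
  · refine antitoneOn_of_hasDerivWithinAt_nonpos (convex_Iic a) hcont.continuousOn
      (fun y _ => (hf y).hasDerivWithinAt) (fun y hy => ?_) hxa Set.self_mem_Iic hxa
    rw [interior_Iic] at hy
    exact ha ▸ hmono (le_of_lt hy)

/-- if `ργ⁴ ≤ 4096/27`, `t > 0`, `x̃ ∈ ℝ`, then `x ↦ φ(x) + (t/2)(x − x̃)²`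
has a unique global minimizer `x*`, which is the unique real solution of
`1 − v e^{−x} + ρ(eˣ/v − γ√(eˣ/v)) + t(x − x̃) = 0`; moreover `φ` is differentiable
with `φ′(x) = 1 − v e^{−x} + ρ(eˣ/v − γ√(eˣ/v))`. -/
theorem stmt18 (v ρ γ : ℝ) (hv : 0 < v) (hρ : 0 < ρ) (hγ : 1 ≤ γ)
    (h : ρ * γ ^ 4 ≤ 4096 / 27) (t : ℝ) (ht : 0 < t) (xt : ℝ) :
    (∀ x : ℝ, HasDerivAt (expFid v ρ γ)
        (1 - v * Real.exp (-x) + ρ * (Real.exp x / v - γ * Real.sqrt (Real.exp x / v))) x) ∧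
    ∃ xstar : ℝ,
      (∀ x : ℝ, expFid v ρ γ xstar + t / 2 * (xstar - xt) ^ 2
        ≤ expFid v ρ γ x + t / 2 * (x - xt) ^ 2) ∧
      (∀ y : ℝ, (∀ x : ℝ, expFid v ρ γ y + t / 2 * (y - xt) ^ 2
        ≤ expFid v ρ γ x + t / 2 * (x - xt) ^ 2) → y = xstar) ∧
      (∀ y : ℝ,
        1 - v * Real.exp (-y) + ρ * (Real.exp y / v - γ * Real.sqrt (Real.exp y / v))
            + t * (y - xt) = 0 ↔ y = xstar) := by
  have hmono := expFidDeriv_monotone hv hρ (by linarith) h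
  have hcont : Continuous (expFidDeriv v ρ γ) := by
    unfold expFidDeriv
    fun_prop
  have hstrict : StrictMono fun x => expFidDeriv v ρ γ x + t * (x - xt) :=
    hmono.add_strictMono fun x y hxy => by
      gcongr
  have hderiv : ∀ x, HasDerivAt (fun x => expFid v ρ γ x + t / 2 * (x - xt) ^ 2)
      (expFidDeriv v ρ γ x + t * (x - xt)) x := fun x => by
    refine ((hasDerivAt_expFid hv ρ γ x).add
      ((((hasDerivAt_id x).sub_const xt).pow 2).const_mul (t / 2))).congr_deriv ?_
    simp
    ring
  obtain ⟨xstar, hzero⟩ := exists_zero_of_monotone_add_linear hmono hcont ht xt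
  have huniq : ∀ y, expFidDeriv v ρ γ y + t * (y - xt) = 0 → y = xstar := fun y hy =>
    hstrict.injective (hy.trans hzero.symm)
  refine ⟨hasDerivAt_expFid hv ρ γ, xstar,
    le_of_hasDerivAt_monotone hderiv hstrict.monotone hzero, fun y hy => huniq y ?_,
    fun y => ⟨huniq y, fun hy => hy ▸ hzero⟩⟩
  have hmin : IsLocalMin (fun x => expFid v ρ γ x + t / 2 * (x - xt) ^ 2) y :=
    Filter.Eventually.of_forall hy
  exact hmin.hasDerivAt_eq_zero (hderiv y)
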